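/- arXiv:1108.5603 — 2 statements merged into one kernel-verified Lean document; each statement's English description precedes it below -/
import Mathlib

section
/- Let n = 2t+1 be odd with t ≥ 2, and let N be an integer with 2^(n−1) < N ≤ 2^(n−1) + C(n−1,t−1) − t − 1. Then there exists a family 𝓐 of subsets of [n] with |𝓐| = N such that for every integer s with 2 ≤ s ≤ N, 𝓐 maximises |𝕀^(s)| over all families of subsets of [n] of size N, and yet 𝓐 is not of the form [n]^(≥t+1) ∪ 𝓑 for any 𝓑 ⊆ [n]^(t). -/
open Finset

/-- The ground set `[n] = {1, …, n}`. -/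
def groundSet (n : ℕ) : Finset ℕ := Finset.Icc 1 n

/-- All subsets of `[n]`. -/
def allFams (n : ℕ) : Finset (Finset ℕ) := (groundSet n).powerset

/-- `[n]^(≥ r)`: subsets of `[n]` of size at least `r`. -/
def layerGE (n r : ℕ) : Finset (Finset ℕ) := (allFams n).filter fun A => r ≤ A.card

/-- `[n]^(r)`: subsets of `[n]` of size exactly `r`. -/
def layerEQ (n r : ℕ) : Finset (Finset ℕ) := (groundSet n).powersetCard r

/-- `𝕀^(s)(𝓐)`: the intersecting subfamilies of `𝓐` of size `s`. -/
def interFams (s : ℕ) (𝓐 : Finset (Finset ℕ)) : Finset (Finset (Finset ℕ)) :=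
  (𝓐.powersetCard s).filter fun 𝓔 => ∀ B ∈ 𝓔, ∀ B' ∈ 𝓔, (B ∩ B').Nonempty

/-- A predicate that complementation negates holds for exactly half of the subsets of `[n]`. -/
theorem card_filter_allFams_of_sdiff_iff_not {n : ℕ} (hn : 1 ≤ n) (p : Finset ℕ → Prop)
    [DecidablePred p] (hp : ∀ B ∈ allFams n, p (groundSet n \ B) ↔ ¬p B) :
    ((allFams n).filter p).card = 2 ^ (n - 1) := by
  have hcard : (allFams n).card = 2 ^ n := by simp [allFams, groundSet]
  have hcompl : ((allFams n).filter p).card = ((allFams n).filter fun B => ¬p B).card := by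
    refine Finset.card_bij' (fun B _ => groundSet n \ B) (fun B _ => groundSet n \ B) ?_ ?_ ?_ ?_
    · intro B hB
      rw [mem_filter] at hB ⊢
      exact ⟨mem_powerset.2 sdiff_subset, fun h => (hp B hB.1).1 h hB.2⟩
    · intro B hB
      rw [mem_filter] at hB ⊢
      exact ⟨mem_powerset.2 sdiff_subset, (hp B hB.1).2 hB.2⟩
    · intro B hB
      exact Finset.sdiff_sdiff_eq_self (mem_powerset.1 (mem_filter.1 hB).1)
    · intro B hB
      exact Finset.sdiff_sdiff_eq_self (mem_powerset.1 (mem_filter.1 hB).1)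
  have hsum := card_filter_add_card_filter_not (s := allFams n) p
  obtain ⟨k, rfl⟩ : ∃ k, n = k + 1 := ⟨n - 1, by omega⟩
  rw [pow_succ] at hcard
  simp only [Nat.add_sub_cancel]
  omega

/-- The members of `𝓐` that contain `1` and whose complement is in `𝓐`; these index the
complementary pairs in `𝓐`. -/
def complPairs (n : ℕ) (𝓐 : Finset (Finset ℕ)) : Finset (Finset ℕ) :=
  𝓐.filter fun B => 1 ∈ B ∧ groundSet n \ B ∈ 𝓐

/-- The subfamilies of `𝓐` of size `s` that contain no complementary pair. -/
def complFree (n s : ℕ) (𝓐 : Finset (Finset ℕ)) : Finset (Finset (Finset ℕ)) :=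
  (𝓐.powersetCard s).filter fun 𝓔 => ∀ B ∈ 𝓔, groundSet n \ B ∉ 𝓔

theorem card_le_two_pow_add_card_complPairs {n : ℕ} (hn : 1 ≤ n) {𝓐 : Finset (Finset ℕ)}
    (h𝓐 : 𝓐 ⊆ allFams n) : 𝓐.card ≤ 2 ^ (n - 1) + (complPairs n 𝓐).card := by
  have h1 : 1 ∈ groundSet n := by simp [groundSet, hn]
  have hstar : ((allFams n).filter fun B => 1 ∈ B).card = 2 ^ (n - 1) :=
    card_filter_allFams_of_sdiff_iff_not hn _ fun B _ => by simp [h1]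
  set P := 𝓐.filter fun B => 1 ∈ B
  set Q := (𝓐.filter fun B => 1 ∉ B).image (groundSet n \ ·) with hQ
  have hQcard : Q.card = (𝓐.filter fun B => 1 ∉ B).card := by
    refine card_image_of_injOn fun B hB C hC h => ?_
    have hB' := mem_powerset.1 (h𝓐 (mem_filter.1 (mem_coe.1 hB)).1)
    have hC' := mem_powerset.1 (h𝓐 (mem_filter.1 (mem_coe.1 hC)).1)
    rw [← Finset.sdiff_sdiff_eq_self hB', ← Finset.sdiff_sdiff_eq_self hC']
    exact congrArg (groundSet n \ ·) h
  have hsplit : P.card + (𝓐.filter fun B => 1 ∉ B).card = 𝓐.card :=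
    card_filter_add_card_filter_not (s := 𝓐) fun B => 1 ∈ B
  have hunion : (P ∪ Q).card ≤ 2 ^ (n - 1) := by
    rw [← hstar]
    refine card_le_card (union_subset ?_ ?_)
    · exact filter_subset_filter _ h𝓐
    · intro B hB
      obtain ⟨C, hC, rfl⟩ := mem_image.1 hB
      simp [allFams, h1, (mem_filter.1 hC).2]
  have hinter : (P ∩ Q).card ≤ (complPairs n 𝓐).card := by
    refine card_le_card fun B hB => ?_
    obtain ⟨hBP, hBQ⟩ := mem_inter.1 hB
    obtain ⟨C, hC, rfl⟩ := mem_image.1 hBQ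
    have hC' := (mem_filter.1 hC).1
    refine mem_filter.2 ⟨(mem_filter.1 hBP).1, (mem_filter.1 hBP).2, ?_⟩
    rwa [Finset.sdiff_sdiff_eq_self (mem_powerset.1 (h𝓐 hC'))]
  have := card_union_add_card_inter P Q
  omega

/-- A bijection between two families of equal size, the first having at most as many complementary
pairs, can be chosen to send complementary pairs to complementary pairs. -/
theorem exists_equiv_of_card_complPairs_le {n : ℕ} (hn : 1 ≤ n) {𝓐 𝓐' : Finset (Finset ℕ)}
    (h𝓐 : 𝓐 ⊆ allFams n) (h𝓐' : 𝓐' ⊆ allFams n) (hcard : 𝓐.card = 𝓐'.card)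
    (hpairs : (complPairs n 𝓐).card ≤ (complPairs n 𝓐').card) :
    ∃ f : 𝓐 ≃ 𝓐', ∀ B C : 𝓐, 1 ∈ B.1 → C.1 = groundSet n \ B.1 →
      (f C).1 = groundSet n \ (f B).1 := by
  have h1 : 1 ∈ groundSet n := by simp [groundSet, hn]
  obtain ⟨T, hT, hTcard⟩ := exists_subset_card_eq hpairs
  let e := Finset.equivOfCardEq hTcard.symm
  let g : Finset ℕ → Finset ℕ := fun B => if h : B ∈ complPairs n 𝓐 then (e ⟨B, h⟩).1 else ∅
  have hg : ∀ B ∈ complPairs n 𝓐, g B ∈ complPairs n 𝓐' := fun B hB => by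
    simp only [g, dif_pos hB]
    exact hT (e ⟨B, hB⟩).2
  have hginj : ∀ B ∈ complPairs n 𝓐, ∀ C ∈ complPairs n 𝓐, g B = g C → B = C :=
    fun B hB C hC h => by
      simp only [g, dif_pos hB, dif_pos hC] at h
      exact congrArg Subtype.val (e.injective (Subtype.ext h))
  let F : 𝓐 → Finset ℕ := fun B =>
    if 1 ∈ B.1 then g B.1 else groundSet n \ g (groundSet n \ B.1)
  let S : Finset 𝓐 := univ.filter fun B => groundSet n \ B.1 ∈ 𝓐
  have hsub : ∀ B : 𝓐, B.1 ⊆ groundSet n := fun B => mem_powerset.1 (h𝓐 B.2)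
  have hpos : ∀ B ∈ S, 1 ∈ B.1 → B.1 ∈ complPairs n 𝓐 := fun B hB hB1 =>
    mem_filter.2 ⟨B.2, hB1, (mem_filter.1 hB).2⟩
  have hneg : ∀ B ∈ S, 1 ∉ B.1 → groundSet n \ B.1 ∈ complPairs n 𝓐 := fun B hB hB1 =>
    mem_filter.2 ⟨(mem_filter.1 hB).2, mem_sdiff.2 ⟨h1, hB1⟩, by
      rw [Finset.sdiff_sdiff_eq_self (hsub B)]; exact B.2⟩
  have hgone : ∀ B ∈ complPairs n 𝓐, 1 ∈ g B := fun B hB => (mem_filter.1 (hg B hB)).2.1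
  have hgsub : ∀ B ∈ complPairs n 𝓐, g B ⊆ groundSet n := fun B hB =>
    mem_powerset.1 (h𝓐' (mem_filter.1 (hg B hB)).1)
  have hmaps : S.image F ⊆ 𝓐' := by
    intro X hX
    obtain ⟨B, hB, rfl⟩ := mem_image.1 hX
    by_cases hB1 : 1 ∈ B.1
    · simp only [F, if_pos hB1]
      exact (mem_filter.1 (hg _ (hpos B hB hB1))).1
    · simp only [F, if_neg hB1]
      exact (mem_filter.1 (hg _ (hneg B hB hB1))).2.2
  have hinj : Set.InjOn F S := by
    intro B hB C hC h
    rw [mem_coe] at hB hC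
    by_cases hB1 : 1 ∈ B.1 <;> by_cases hC1 : 1 ∈ C.1 <;>
      simp only [F, hB1, hC1, if_true, if_false] at h
    · exact Subtype.ext (hginj _ (hpos B hB hB1) _ (hpos C hC hC1) h)
    · have := hgone _ (hpos B hB hB1)
      rw [h] at this
      exact absurd (hgone _ (hneg C hC hC1)) (mem_sdiff.1 this).2
    · have := hgone _ (hpos C hC hC1)
      rw [← h] at this
      exact absurd (hgone _ (hneg B hB hB1)) (mem_sdiff.1 this).2
    · have h' := congrArg (groundSet n \ ·) h
      simp only [Finset.sdiff_sdiff_eq_self (hgsub _ (hneg B hB hB1)),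
        Finset.sdiff_sdiff_eq_self (hgsub _ (hneg C hC hC1))] at h'
      have h'' := congrArg (groundSet n \ ·) (hginj _ (hneg B hB hB1) _ (hneg C hC hC1) h')
      simp only [Finset.sdiff_sdiff_eq_self (hsub _)] at h''
      exact Subtype.ext h''
  obtain ⟨f, hf⟩ := Finset.exists_equiv_extend_of_card_eq (by simpa using hcard) hmaps hinj
  refine ⟨f, fun B C hB1 hC => ?_⟩
  have hBS : B ∈ S := mem_filter.2 ⟨mem_univ _, hC ▸ C.2⟩
  have hBC : groundSet n \ C.1 = B.1 := by rw [hC, Finset.sdiff_sdiff_eq_self (hsub B)]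
  have hCS : C ∈ S := mem_filter.2 ⟨mem_univ _, hBC ▸ B.2⟩
  have hC1 : 1 ∉ C.1 := by simp [hC, hB1]
  rw [hf B hBS, hf C hCS]
  simp only [F, if_pos hB1, if_neg hC1, hBC]

theorem card_complFree_le {n : ℕ} (hn : 1 ≤ n) (s : ℕ) {𝓐 𝓐' : Finset (Finset ℕ)}
    (h𝓐 : 𝓐 ⊆ allFams n) (h𝓐' : 𝓐' ⊆ allFams n) (hcard : 𝓐.card = 𝓐'.card)
    (hpairs : (complPairs n 𝓐).card ≤ (complPairs n 𝓐').card) :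
    (complFree n s 𝓐').card ≤ (complFree n s 𝓐).card := by
  have h1 : 1 ∈ groundSet n := by simp [groundSet, hn]
  obtain ⟨f, hf⟩ := exists_equiv_of_card_complPairs_le hn h𝓐 h𝓐' hcard hpairs
  let pull : Finset (Finset ℕ) → Finset (Finset ℕ) := fun 𝓔 =>
    (univ.filter fun B : 𝓐 => (f B).1 ∈ 𝓔).map (Function.Embedding.subtype _)
  have hmem : ∀ 𝓔 (B : 𝓐), B.1 ∈ pull 𝓔 ↔ (f B).1 ∈ 𝓔 := fun 𝓔 B => by
    simp [pull]
  have hpull : ∀ 𝓔, pull 𝓔 ⊆ 𝓐 := fun 𝓔 X hX => by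
    obtain ⟨B, -, rfl⟩ := mem_map.1 hX
    exact B.2
  refine card_le_card_of_injOn pull ?_ ?_
  · intro 𝓔 h𝓔
    obtain ⟨h𝓔, hfree⟩ := mem_filter.1 (mem_coe.1 h𝓔)
    obtain ⟨hsub, hs⟩ := mem_powersetCard.1 h𝓔
    refine mem_coe.2 (mem_filter.2 ⟨mem_powersetCard.2 ⟨hpull 𝓔, ?_⟩, ?_⟩)
    · rw [← hs, card_map]
      refine card_bij (fun B _ => (f B).1) (fun B hB => (mem_filter.1 hB).2)
        (fun B _ C _ h => f.injective (Subtype.ext h)) fun X hX => ?_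
      exact ⟨f.symm ⟨X, hsub hX⟩, by simpa using hX, by simp⟩
    · have key : ∀ B C : 𝓐, 1 ∈ B.1 → C.1 = groundSet n \ B.1 → B.1 ∈ pull 𝓔 →
          C.1 ∉ pull 𝓔 := fun B C hB1 hC hB hC' => by
        rw [hmem] at hB hC'
        rw [hf B C hB1 hC] at hC'
        exact hfree _ hB hC'
      intro X hX hX'
      by_cases hX1 : 1 ∈ X
      · exact key ⟨X, hpull _ hX⟩ ⟨_, hpull _ hX'⟩ hX1 rfl hX hX'
      · refine key ⟨_, hpull _ hX'⟩ ⟨X, hpull _ hX⟩ (mem_sdiff.2 ⟨h1, hX1⟩) ?_ hX' hX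
        exact (Finset.sdiff_sdiff_eq_self (mem_powerset.1 (h𝓐 (hpull _ hX)))).symm
  · intro 𝓔 h𝓔 𝓕 h𝓕 h
    have h𝓔' := (mem_powersetCard.1 (mem_filter.1 (mem_coe.1 h𝓔)).1).1
    have h𝓕' := (mem_powersetCard.1 (mem_filter.1 (mem_coe.1 h𝓕)).1).1
    have key : ∀ X (hX : X ∈ 𝓐'), X ∈ 𝓔 ↔ X ∈ 𝓕 := fun X hX => by
      have h2 := hmem 𝓔 (f.symm ⟨X, hX⟩)
      have h3 := hmem 𝓕 (f.symm ⟨X, hX⟩)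
      rw [h] at h2
      simpa using h2.symm.trans h3
    ext X
    exact ⟨fun hX => (key X (h𝓔' hX)).1 hX, fun hX => (key X (h𝓕' hX)).2 hX⟩

theorem interFams_subset_complFree (n s : ℕ) (𝓐 : Finset (Finset ℕ)) :
    interFams s 𝓐 ⊆ complFree n s 𝓐 := fun 𝓔 h𝓔 => by
  obtain ⟨h𝓔, hint⟩ := mem_filter.1 h𝓔
  refine mem_filter.2 ⟨h𝓔, fun B hB hB' => ?_⟩
  simpa using hint B hB _ hB'

theorem complFree_subset_interFams {n : ℕ} (s : ℕ) {𝓐 : Finset (Finset ℕ)}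
    (h : ∀ B ∈ 𝓐, ∀ C ∈ 𝓐, Disjoint B C → C = groundSet n \ B) :
    complFree n s 𝓐 ⊆ interFams s 𝓐 := fun 𝓔 h𝓔 => by
  obtain ⟨h𝓔, hfree⟩ := mem_filter.1 h𝓔
  have hsub := (mem_powersetCard.1 h𝓔).1
  refine mem_filter.2 ⟨h𝓔, fun B hB C hC => ?_⟩
  rw [← not_disjoint_iff_nonempty_inter]
  intro hd
  exact hfree B hB (h B (hsub hB) C (hsub hC) hd ▸ hC)

theorem card_layerEQ_filter_one_mem {n r : ℕ} (hn : 1 ≤ n) (hr : 1 ≤ r) :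
    ((layerEQ n r).filter fun B => 1 ∈ B).card = (n - 1).choose (r - 1) := by
  have hcard : (Icc 2 n).card = n - 1 := by simp
  rw [← hcard, ← card_powersetCard]
  refine card_bij' (fun B _ => B.erase 1) (fun B _ => insert 1 B) ?_ ?_ ?_ ?_
  · intro B hB
    simp only [layerEQ, groundSet, mem_filter, mem_powersetCard] at hB
    obtain ⟨⟨hsub, hc⟩, h1⟩ := hB
    refine mem_powersetCard.2 ⟨fun x hx => ?_, by rw [card_erase_of_mem h1, hc]⟩
    have hx' := mem_Icc.1 (hsub (mem_of_mem_erase hx))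
    have := ne_of_mem_erase hx
    exact mem_Icc.2 ⟨by omega, hx'.2⟩
  · intro B hB
    obtain ⟨hsub, hc⟩ := mem_powersetCard.1 hB
    have h1 : 1 ∉ B := fun h => by simpa using hsub h
    simp only [layerEQ, groundSet, mem_filter, mem_powersetCard]
    refine ⟨⟨insert_subset (by simp [hn]) (hsub.trans (Icc_subset_Icc_left (by omega))), ?_⟩,
      mem_insert_self _ _⟩
    rw [card_insert_of_notMem h1]
    omega
  · intro B hB
    exact insert_erase (mem_filter.1 hB).2
  · intro B hB
    refine erase_insert fun h => ?_
    simpa using (mem_powersetCard.1 hB).1 h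

theorem stmt17 (n t N : ℕ) (ht : 2 ≤ t) (hnt : n = 2 * t + 1)
    (hN1 : 2 ^ (n - 1) < N) (hN2 : N ≤ 2 ^ (n - 1) + (n - 1).choose (t - 1) - t - 1) :
    ∃ 𝓐 ⊆ allFams n, 𝓐.card = N ∧
      (∀ s, 2 ≤ s → s ≤ N → ∀ 𝓐' ⊆ allFams n, 𝓐'.card = N →
        (interFams s 𝓐').card ≤ (interFams s 𝓐).card) ∧
      ¬∃ 𝓑 ⊆ layerEQ n t, 𝓐 = layerGE n (t + 1) ∪ 𝓑 := by
  have hn : 1 ≤ n := by omega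
  have hground : (groundSet n).card = n := by simp [groundSet]
  have hstar := card_layerEQ_filter_one_mem (n := n) (r := t) hn (by omega)
  have hGE : (layerGE n (t + 1)).card = 2 ^ (n - 1) :=
    card_filter_allFams_of_sdiff_iff_not hn _ fun B hB => by
      have hB := mem_powerset.1 hB
      have := card_le_card hB
      rw [card_sdiff_of_subset hB, hground]
      omega
  obtain ⟨𝓗, h𝓗, h𝓗card⟩ := exists_subset_card_eq
    (s := (layerEQ n t).filter fun B => 1 ∈ B) (n := N - 2 ^ (n - 1) + 1) (by omega)
  obtain ⟨B₀, hB₀⟩ : 𝓗.Nonempty := card_pos.1 (by omega)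
  have h𝓗' : ∀ B ∈ 𝓗, B ⊆ groundSet n ∧ B.card = t ∧ 1 ∈ B := fun B hB => by
    have := mem_filter.1 (h𝓗 hB)
    have h2 := mem_powersetCard.1 this.1
    exact ⟨h2.1, h2.2, this.2⟩
  have hGE' : ∀ B ∈ layerGE n (t + 1), B ⊆ groundSet n ∧ t + 1 ≤ B.card := fun B hB => by
    have := mem_filter.1 hB
    exact ⟨mem_powerset.1 this.1, this.2⟩
  have hA₀card : (groundSet n \ B₀).card = t + 1 := by
    rw [card_sdiff_of_subset (h𝓗' B₀ hB₀).1, hground, (h𝓗' B₀ hB₀).2.1]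
    omega
  have hA₀ : groundSet n \ B₀ ∈ layerGE n (t + 1) :=
    mem_filter.2 ⟨mem_powerset.2 sdiff_subset, hA₀card.ge⟩
  set 𝓐 := (layerGE n (t + 1)).erase (groundSet n \ B₀) ∪ 𝓗 with h𝓐def
  have h𝓐 : 𝓐 ⊆ allFams n := union_subset ((erase_subset _ _).trans (filter_subset _ _))
    fun B hB => mem_powerset.2 (h𝓗' B hB).1
  have h𝓐card : 𝓐.card = N := by
    rw [card_union_of_disjoint, card_erase_of_mem hA₀, hGE, h𝓗card]
    · have : 0 < 2 ^ (n - 1) := by positivity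
      omega
    · refine disjoint_left.2 fun B hB hB' => ?_
      have h2 := (hGE' B (mem_of_mem_erase hB)).2
      have h3 := (h𝓗' B hB').2.1
      omega
  have hpairs : (complPairs n 𝓐).card ≤ N - 2 ^ (n - 1) := by
    have : complPairs n 𝓐 ⊆ 𝓗.erase B₀ := fun B hB => by
      obtain ⟨hB𝓐, hB1, hBc⟩ := mem_filter.1 hB
      have hBsub := mem_powerset.1 (h𝓐 hB𝓐)
      have hBc' : groundSet n \ B ∈ (layerGE n (t + 1)).erase (groundSet n \ B₀) :=
        (mem_union.1 hBc).resolve_right fun h => by simpa [hB1] using (h𝓗' _ h).2.2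
      refine mem_erase.2 ⟨fun h => ?_, (mem_union.1 hB𝓐).resolve_left fun h => ?_⟩
      · exact ne_of_mem_erase hBc' (by rw [h])
      · have h2 := (hGE' _ (mem_of_mem_erase hBc')).2
        have h3 := (hGE' _ (mem_of_mem_erase h)).2
        rw [card_sdiff_of_subset hBsub, hground] at h2
        omega
    have := card_le_card this
    rw [card_erase_of_mem hB₀] at this
    omega
  have hdisj : ∀ B ∈ 𝓐, ∀ C ∈ 𝓐, Disjoint B C → C = groundSet n \ B := by
    intro B hB C hC hd
    have hBsub := mem_powerset.1 (h𝓐 hB)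
    have hCsub := mem_powerset.1 (h𝓐 hC)
    refine eq_of_subset_of_card_le (subset_sdiff.2 ⟨hCsub, hd.symm⟩) ?_
    rw [card_sdiff_of_subset hBsub, hground]
    rcases mem_union.1 hB with hB | hB <;> rcases mem_union.1 hC with hC | hC
    · have := (hGE' _ (mem_of_mem_erase hB)).2
      have := (hGE' _ (mem_of_mem_erase hC)).2
      omega
    · have := (hGE' _ (mem_of_mem_erase hB)).2
      have := (h𝓗' _ hC).2.1
      omega
    · have := (hGE' _ (mem_of_mem_erase hC)).2
      have := (h𝓗' _ hB).2.1
      omega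
    · exact absurd (h𝓗' _ hC).2.2 (disjoint_left.1 hd (h𝓗' _ hB).2.2)
  refine ⟨𝓐, h𝓐, h𝓐card, fun s _ _ 𝓐' h𝓐' h𝓐'card => ?_, ?_⟩
  · have hpairs' := card_le_two_pow_add_card_complPairs hn h𝓐'
    calc (interFams s 𝓐').card ≤ (complFree n s 𝓐').card :=
          card_le_card (interFams_subset_complFree n s 𝓐')
      _ ≤ (complFree n s 𝓐).card :=
          card_complFree_le hn s h𝓐 h𝓐' (h𝓐card.trans h𝓐'card.symm) (by omega)
      _ ≤ (interFams s 𝓐).card := card_le_card (complFree_subset_interFams s hdisj)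
  · rintro ⟨𝓑, -, h⟩
    have hmem : groundSet n \ B₀ ∈ 𝓐 := h ▸ mem_union_left _ hA₀
    rcases mem_union.1 hmem with h' | h'
    · exact ne_of_mem_erase h' rfl
    · have := (h𝓗' _ h').2.1
      omega
end

section
/- Let n = 2t be even with t ≥ 2, and let 𝓐 = {[t−1]} ∪ ([n]^(≥t) \ {A ∈ [n]^(t) : A ∩ [t−1] = ∅}). Then: (i) |𝓐| = 2^(n−1) + C(n,t)/2 − t; (ii) 𝓐 meets every complementary pair, i.e. for every S ⊆ [n], S ∈ 𝓐 or [n] \ S ∈ 𝓐; and (iii) the only non-intersecting pairs in 𝓐 are complementary, i.e. whenever A, A' ∈ 𝓐 and A ∩ A' = ∅, then A' = [n] \ A. -/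
open Finset

lemma card_groundSet (n : ℕ) : (groundSet n).card = n := by
  simp [groundSet]

lemma mem_allFams {n : ℕ} {A : Finset ℕ} : A ∈ allFams n ↔ A ⊆ groundSet n := by
  simp [allFams]

/-- In a ground set of size `2 * t`, complementation matches the sets of size at most `t` with
those of size at least `t`. -/
lemma two_mul_card_layerGE (t : ℕ) :
    2 * (layerGE (2 * t) t).card = 2 ^ (2 * t) + (2 * t).choose t := by
  have h_compl : ((allFams (2 * t)).filter fun A => A.card ≤ t).card =
      (layerGE (2 * t) t).card := by
    refine Finset.card_nbij' (fun A => groundSet (2 * t) \ A)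
      (fun A => groundSet (2 * t) \ A) ?_ ?_ ?_ ?_
    · intro A hA
      simp only [coe_filter, Set.mem_ofPred_eq, mem_allFams] at hA
      simp only [layerGE, coe_filter, Set.mem_ofPred_eq, mem_allFams,
        card_sdiff_of_subset hA.1, card_groundSet]
      exact ⟨sdiff_subset, by omega⟩
    · intro A hA
      simp only [layerGE, coe_filter, Set.mem_ofPred_eq, mem_allFams] at hA
      simp only [coe_filter, Set.mem_ofPred_eq, mem_allFams,
        card_sdiff_of_subset hA.1, card_groundSet]
      exact ⟨sdiff_subset, by omega⟩
    · intro A hA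
      simp only [coe_filter, Set.mem_ofPred_eq, mem_allFams] at hA
      exact Finset.sdiff_sdiff_eq_self hA.1
    · intro A hA
      simp only [layerGE, coe_filter, Set.mem_ofPred_eq, mem_allFams] at hA
      exact Finset.sdiff_sdiff_eq_self hA.1
  have h_union : ((allFams (2 * t)).filter fun A => A.card ≤ t) ∪ layerGE (2 * t) t =
      allFams (2 * t) := by
    ext A
    simp only [layerGE, mem_union, mem_filter]
    have := le_total A.card t
    tauto
  have h_inter : ((allFams (2 * t)).filter fun A => A.card ≤ t) ∩ layerGE (2 * t) t =
      (groundSet (2 * t)).powersetCard t := by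
    ext A
    simp only [layerGE, mem_inter, mem_filter, mem_powersetCard, mem_allFams, le_antisymm_iff]
    tauto
  have h := card_union_add_card_inter
    ((allFams (2 * t)).filter fun A => A.card ≤ t) (layerGE (2 * t) t)
  rw [h_union, h_inter, h_compl, card_powersetCard, card_groundSet, allFams, card_powerset,
    card_groundSet] at h
  omega

/-- The sets of size `t` avoiding `[t - 1]` are the `t`-subsets of `{t, …, 2 * t}`. -/
lemma card_filter_disjoint_Icc (t : ℕ) (ht : 1 ≤ t) :
    ((layerGE (2 * t) t).filter fun A => A.card = t ∧ A ∩ Finset.Icc 1 (t - 1) = ∅).card =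
      t + 1 := by
  have h_eq : ((layerGE (2 * t) t).filter fun A =>
      A.card = t ∧ A ∩ Finset.Icc 1 (t - 1) = ∅) = (Finset.Icc t (2 * t)).powersetCard t := by
    ext A
    simp only [layerGE, mem_filter, mem_powersetCard, mem_allFams, ← disjoint_iff_inter_eq_empty,
      disjoint_left, subset_iff, groundSet, mem_Icc]
    constructor
    · rintro ⟨⟨h_sub, -⟩, h_card, h_disj⟩
      refine ⟨fun x hx => ?_, h_card⟩
      have h_one := h_sub hx
      have h_two := h_disj hx
      omega
    · rintro ⟨h_sub, h_card⟩
      refine ⟨⟨fun x hx => ?_, h_card.ge⟩, h_card, fun x hx => ?_⟩ <;>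
        have h_one := h_sub hx <;> omega
  rw [h_eq, card_powersetCard, Nat.card_Icc, show 2 * t + 1 - t = t + 1 by omega,
    Nat.choose_succ_self_right]

/-- Disjoint subsets of a finite set whose sizes add up to at least its size are complementary. -/
lemma eq_sdiff_of_inter_eq_empty {G A B : Finset ℕ} (hA : A ⊆ G) (hB : B ⊆ G)
    (h_inter : A ∩ B = ∅) (h_card : G.card ≤ A.card + B.card) : B = G \ A := by
  have h_disj : Disjoint B A := (disjoint_iff_inter_eq_empty.2 h_inter).symm
  refine eq_of_subset_of_card_le (subset_sdiff.2 ⟨hB, h_disj⟩) ?_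
  rw [card_sdiff_of_subset hA]
  omega

theorem stmt18 (n t : ℕ) (ht : 2 ≤ t) (hnt : n = 2 * t)
    (𝓐 : Finset (Finset ℕ))
    (h𝓐 : 𝓐 = insert (Finset.Icc 1 (t - 1))
        ((allFams n).filter fun A =>
          t ≤ A.card ∧ ¬(A.card = t ∧ A ∩ Finset.Icc 1 (t - 1) = ∅))) :
    𝓐.card = 2 ^ (n - 1) + n.choose t / 2 - t ∧
      (∀ S ⊆ groundSet n, S ∈ 𝓐 ∨ groundSet n \ S ∈ 𝓐) ∧
      ∀ A ∈ 𝓐, ∀ A' ∈ 𝓐, A ∩ A' = ∅ → A' = groundSet n \ A := by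
  subst hnt
  have h_card_Icc : (Finset.Icc 1 (t - 1)).card = t - 1 := by simp
  have h_Icc_sub : Finset.Icc 1 (t - 1) ⊆ groundSet (2 * t) :=
    Finset.Icc_subset_Icc le_rfl (by omega)
  have h_one_mem : 1 ∈ Finset.Icc 1 (t - 1) := by
    rw [mem_Icc]
    omega
  subst h𝓐
  refine ⟨?_, ?_, ?_⟩
  · rw [card_insert_of_notMem (by
      simp only [mem_filter, h_card_Icc]
      omega), ← filter_filter]
    change ((layerGE (2 * t) t).filter _).card + 1 = _
    have h_split := card_filter_add_card_filter_not (s := layerGE (2 * t) t)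
      (fun A => A.card = t ∧ A ∩ Finset.Icc 1 (t - 1) = ∅)
    rw [card_filter_disjoint_Icc t (by omega)] at h_split
    have h_two := two_mul_card_layerGE t
    have h_pow : 2 ^ (2 * t) = 2 * 2 ^ (2 * t - 1) := by
      rw [← pow_succ', Nat.sub_add_cancel (by omega)]
    omega
  · intro S hS
    have h_card := card_sdiff_add_card_eq_card hS
    rw [card_groundSet] at h_card
    simp only [mem_insert, mem_filter, mem_allFams]
    by_cases h_bad : t ≤ S.card ∧ ¬(S.card = t ∧ S ∩ Finset.Icc 1 (t - 1) = ∅)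
    · exact Or.inl (Or.inr ⟨hS, h_bad⟩)
    · refine Or.inr (Or.inr ⟨sdiff_subset, ?_, ?_⟩)
      · by_contra h_lt
        exact h_bad ⟨by omega, fun h_eq => by omega⟩
      · rintro ⟨h_eq, h_compl⟩
        refine h_bad ⟨by omega, fun h_S => ?_⟩
        have h_notMem : 1 ∉ S := fun h_mem =>
          disjoint_left.1 (disjoint_iff_inter_eq_empty.2 h_S.2) h_mem h_one_mem
        exact disjoint_left.1 (disjoint_iff_inter_eq_empty.2 h_compl)
          (mem_sdiff.2 ⟨h_Icc_sub h_one_mem, h_notMem⟩) h_one_mem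
  · intro A hA B hB h_inter
    simp only [mem_insert, mem_filter, mem_allFams] at hA hB
    rcases hA with rfl | ⟨hA, h_cardA, h_badA⟩ <;> rcases hB with rfl | ⟨hB, h_cardB, h_badB⟩
    · rw [inter_self] at h_inter
      simp [h_inter] at h_one_mem
    · refine eq_sdiff_of_inter_eq_empty h_Icc_sub hB h_inter ?_
      have h_ne : B.card ≠ t := fun h => h_badB ⟨h, by rwa [inter_comm]⟩
      rw [card_groundSet]
      omega
    · refine eq_sdiff_of_inter_eq_empty hA h_Icc_sub h_inter ?_
      have h_ne : A.card ≠ t := fun h => h_badA ⟨h, h_inter⟩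
      rw [card_groundSet]
      omega
    · refine eq_sdiff_of_inter_eq_empty hA hB h_inter ?_
      rw [card_groundSet]
      omega
end
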